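/- arXiv:2409.13995 — 8 statements merged into one kernel-verified Lean document; each statement's English description precedes it below -/
import Mathlib

section
/- Assume θ = 1. Let P₀ ∈ [0,1], v₀ = (1+P₀)^{k2}, and û₊ = (0, v₀, P₀). Then the characteristic polynomial of the Jacobian DF(û₊) factors as det(DF(û₊) − λI) = −λ·(a − λ)·(b − λ), where a = (1+P₀)^{k1}·Γ/(1+exp(−β(v₀−α))) − ω and b = −(1+P₀)^{−k2}. In particular, the eigenvalues of DF(û₊) are 0, a, and b, and b < 0. -/
open Real Filter

/-- Kinetics `f(u,v,P)` of the protest model. -/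
noncomputable def fkin (α β Γ ω k1 : ℝ) (u v P : ℝ) : ℝ :=
  (1 + P) ^ k1 * (1 / (1 + Real.exp (-β * (v - α)))) * (Γ * u * (1 - u)) - ω * u

/-- Kinetics `g(u,v,P)` of the protest model. -/
noncomputable def gkin (θ k0 k2 : ℝ) (u v P : ℝ) : ℝ :=
  1 - (1 + P) ^ (-k2) * θ * (1 + u) ^ (-k0) * v

/-- Kinetics `s(u,v,P)` of the protest model. -/
def skin (u v P : ℝ) : ℝ := u * (1 - P)

/-- Partial derivative `∂f/∂u`. -/
noncomputable def f_u (α β Γ ω k1 u v P : ℝ) : ℝ := deriv (fun x => fkin α β Γ ω k1 x v P) u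
/-- Partial derivative `∂f/∂v`. -/
noncomputable def f_v (α β Γ ω k1 u v P : ℝ) : ℝ := deriv (fun x => fkin α β Γ ω k1 u x P) v
/-- Partial derivative `∂f/∂P`. -/
noncomputable def f_P (α β Γ ω k1 u v P : ℝ) : ℝ := deriv (fun x => fkin α β Γ ω k1 u v x) P
/-- Partial derivative `∂g/∂u`. -/
noncomputable def g_u (θ k0 k2 u v P : ℝ) : ℝ := deriv (fun x => gkin θ k0 k2 x v P) u
/-- Partial derivative `∂g/∂v`. -/
noncomputable def g_v (θ k0 k2 u v P : ℝ) : ℝ := deriv (fun x => gkin θ k0 k2 u x P) v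
/-- Partial derivative `∂g/∂P`. -/
noncomputable def g_P (θ k0 k2 u v P : ℝ) : ℝ := deriv (fun x => gkin θ k0 k2 u v x) P
/-- Partial derivative `∂s/∂u`. -/
noncomputable def s_u (u v P : ℝ) : ℝ := deriv (fun x => skin x v P) u
/-- Partial derivative `∂s/∂v`. -/
noncomputable def s_v (u v P : ℝ) : ℝ := deriv (fun x => skin u x P) v
/-- Partial derivative `∂s/∂P`. -/
noncomputable def s_P (u v P : ℝ) : ℝ := deriv (fun x => skin u v x) P

/-- The Jacobian matrix `DF` of `F = (f,g,s)` in the variables `(u,v,P)`. -/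
noncomputable def DF (α β Γ ω θ k0 k1 k2 : ℝ) (u v P : ℝ) : Matrix (Fin 3) (Fin 3) ℝ :=
  !![f_u α β Γ ω k1 u v P, f_v α β Γ ω k1 u v P, f_P α β Γ ω k1 u v P;
     g_u θ k0 k2 u v P, g_v θ k0 k2 u v P, g_P θ k0 k2 u v P;
     s_u u v P, s_v u v P, s_P u v P]

/-- with θ = 1, at the trivial steady state `û₊ = (0, v₀, P₀)` with
`v₀ = (1+P₀)^{k2}`, `P₀ ∈ [0,1]`, the characteristic polynomial of the Jacobian factors as
`det(DF(û₊) − λI) = −λ·(a − λ)·(b − λ)` with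
`a = (1+P₀)^{k1}·Γ/(1+exp(−β(v₀−α))) − ω` and `b = −(1+P₀)^{−k2}`; in particular the
eigenvalues of `DF(û₊)` are `0`, `a`, `b`, and `b < 0`. -/
theorem stmt6 (α β Γ ω θ k0 k1 k2 : ℝ) (hθ : θ = 1)
    (P₀ : ℝ) (hP₀ : P₀ ∈ Set.Icc (0 : ℝ) 1) :
    (∀ lam : ℝ,
      Matrix.det (DF α β Γ ω θ k0 k1 k2 0 ((1 + P₀) ^ k2) P₀ -
          lam • (1 : Matrix (Fin 3) (Fin 3) ℝ)) =
        -lam * (((1 + P₀) ^ k1 * Γ / (1 + Real.exp (-β * ((1 + P₀) ^ k2 - α))) - ω) - lam) *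
          ((-(1 + P₀) ^ (-k2)) - lam)) ∧
    (∀ μ : ℝ,
      Matrix.det (DF α β Γ ω θ k0 k1 k2 0 ((1 + P₀) ^ k2) P₀ -
          μ • (1 : Matrix (Fin 3) (Fin 3) ℝ)) = 0 ↔
        μ = 0 ∨ μ = (1 + P₀) ^ k1 * Γ / (1 + Real.exp (-β * ((1 + P₀) ^ k2 - α))) - ω ∨
          μ = -(1 + P₀) ^ (-k2)) ∧
    (-(1 + P₀) ^ (-k2) : ℝ) < 0 := by
  have hp : (0 : ℝ) < 1 + P₀ := by linarith [hP₀.1]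
  have hb : (-(1 + P₀) ^ (-k2) : ℝ) < 0 := neg_neg_of_pos (Real.rpow_pos_of_pos hp _)
  have hmain : ∀ lam : ℝ,
      Matrix.det (DF α β Γ ω θ k0 k1 k2 0 ((1 + P₀) ^ k2) P₀ -
          lam • (1 : Matrix (Fin 3) (Fin 3) ℝ)) =
        -lam * (((1 + P₀) ^ k1 * Γ / (1 + Real.exp (-β * ((1 + P₀) ^ k2 - α))) - ω) - lam) *
          ((-(1 + P₀) ^ (-k2)) - lam) := by
    intro lam
    subst hθ
    generalize (1 + P₀) ^ k2 = v
    have h1 : f_u α β Γ ω k1 0 v P₀ =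
        (1 + P₀) ^ k1 * Γ / (1 + Real.exp (-β * (v - α))) - ω := by
      unfold f_u fkin
      generalize (1 + P₀) ^ k1 = A
      generalize 1 + Real.exp (-β * (v - α)) = B
      have h := (((((hasDerivAt_id (0 : ℝ)).const_mul Γ).mul
        ((hasDerivAt_id (0 : ℝ)).const_sub 1)).const_mul (A * (1 / B))).sub
        ((hasDerivAt_id (0 : ℝ)).const_mul ω))
      refine Eq.trans h.deriv ?_
      simp
      ring
    have h2 : f_v α β Γ ω k1 0 v P₀ = 0 := by simp [f_v, fkin]
    have h3 : f_P α β Γ ω k1 0 v P₀ = 0 := by simp [f_P, fkin]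
    have h4 : g_v 1 k0 k2 0 v P₀ = -(1 + P₀) ^ (-k2) := by
      unfold g_v gkin
      have h := ((hasDerivAt_id v).const_mul
        ((1 + P₀) ^ (-k2) * 1 * (1 + (0:ℝ)) ^ (-k0))).const_sub 1
      refine Eq.trans h.deriv ?_
      simp
    have h5 : s_v 0 v P₀ = 0 := by simp [s_v, skin]
    have h6 : s_P 0 v P₀ = 0 := by simp [s_P, skin]
    rw [Matrix.det_fin_three]
    simp [DF, h1, h2, h3, h4, h5, h6]
    ring
  refine ⟨hmain, fun μ => ?_, hb⟩
  rw [hmain μ, mul_eq_zero, mul_eq_zero, neg_eq_zero, sub_eq_zero, sub_eq_zero, or_assoc,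
    eq_comm (b := μ), eq_comm (b := μ)]
end

section
/- Assume θ = 1, α, β, Γ, ω > 0. Let û₋ = (u*, v*, 1) be a zero of F with 0 < u* < 1 and v* > 0. Then f_u(û₋) = −2^{k1}·Γ·u*/(1+exp(−β(v*−α))) < 0 and g_v(û₋) = −1/v* < 0; consequently f_u(û₋) + g_v(û₋) < 0. -/
open Real Filter

/-- at a nontrivial steady state `û₋ = (u*, v*, 1)` (a zero of `F`, with
`0 < u* < 1`, `v* > 0`), one has `f_u(û₋) = −2^{k1}·Γ·u*/(1+exp(−β(v*−α))) < 0` and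
`g_v(û₋) = −1/v* < 0`; consequently `f_u(û₋) + g_v(û₋) < 0`. -/
theorem stmt8 (α β Γ ω θ k0 k1 k2 : ℝ) (hθ : θ = 1)
    (hα : 0 < α) (hβ : 0 < β) (hΓ : 0 < Γ) (hω : 0 < ω)
    (ustar vstar : ℝ)
    (hzero : fkin α β Γ ω k1 ustar vstar 1 = 0 ∧ gkin θ k0 k2 ustar vstar 1 = 0 ∧
      skin ustar vstar 1 = 0)
    (hu0 : 0 < ustar) (hu1 : ustar < 1) (hv : 0 < vstar) :
    f_u α β Γ ω k1 ustar vstar 1 =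
      -((2 : ℝ) ^ k1 * Γ * ustar / (1 + Real.exp (-β * (vstar - α)))) ∧
    f_u α β Γ ω k1 ustar vstar 1 < 0 ∧
    g_v θ k0 k2 ustar vstar 1 = -(1 / vstar) ∧
    g_v θ k0 k2 ustar vstar 1 < 0 ∧
    f_u α β Γ ω k1 ustar vstar 1 + g_v θ k0 k2 ustar vstar 1 < 0 := by
  obtain ⟨hf, hg, -⟩ := hzero
  have h2 : (1 + 1 : ℝ) = 2 := by norm_num
  have hE : 0 < 1 + Real.exp (-β * (vstar - α)) := by positivity
  have hp : 0 < (2 : ℝ) ^ k1 := by positivity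
  simp only [fkin, gkin, h2] at hf hg
  have e1 : f_u α β Γ ω k1 ustar vstar 1 =
      -((2 : ℝ) ^ k1 * Γ * ustar / (1 + Real.exp (-β * (vstar - α)))) := by
    simp only [f_u, fkin, h2]
    generalize (2 : ℝ) ^ k1 = A at *
    generalize 1 + Real.exp (-β * (vstar - α)) = E at *
    have hd : HasDerivAt (fun x : ℝ => A * (1 / E) * (Γ * x * (1 - x)) - ω * x)
        (A * (1 / E) * (Γ * 1 * (1 - ustar) + Γ * ustar * (-1)) - ω * 1) ustar :=
      ((((hasDerivAt_id' ustar).const_mul Γ).mul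
        ((hasDerivAt_id' ustar).const_sub 1)).const_mul (A * (1 / E))).sub
        ((hasDerivAt_id' ustar).const_mul ω)
    rw [hd.deriv]
    have h : A * (1 / E) * (Γ * (1 - ustar)) - ω = 0 := by
      apply mul_left_cancel₀ hu0.ne'
      linear_combination hf
    linear_combination h
  have e2 : g_v θ k0 k2 ustar vstar 1 = -(1 / vstar) := by
    simp only [g_v, gkin, h2]
    generalize (2 : ℝ) ^ (-k2) * θ * (1 + ustar) ^ (-k0) = B at *
    have hd : HasDerivAt (fun x : ℝ => 1 - B * x) (-(B * 1)) vstar :=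
      ((hasDerivAt_id' vstar).const_mul B).const_sub 1
    rw [hd.deriv]
    field_simp
    linear_combination hg
  have n1 : f_u α β Γ ω k1 ustar vstar 1 < 0 := by
    rw [e1]
    exact neg_neg_of_pos (by positivity)
  have n2 : g_v θ k0 k2 ustar vstar 1 < 0 := by
    rw [e2]
    exact neg_neg_of_pos (by positivity)
  exact ⟨e1, n1, e2, n2, add_neg n1 n2⟩
end

section
/- Assume θ = 1, α, β, Γ, ω > 0 and k0 ∈ ℝ. Let û₋ = (u*, v*, 1) be a zero of F with 0 < u* < 1 and v* > 0. Then the inequality f_v(û₋)·g_u(û₋) − f_u(û₋)·g_v(û₋) < 0 holds if and only if ω·β·k0·exp(−β(v*−α))·v*/(1+u*) < 2^{k1}·Γ. -/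
open Real Filter

/-- at a nontrivial steady state `û₋ = (u*, v*, 1)` (a zero of `F`, with
`0 < u* < 1`, `v* > 0`), the inequality `f_v·g_u − f_u·g_v < 0` holds iff
`ω·β·k0·exp(−β(v*−α))·v*/(1+u*) < 2^{k1}·Γ`. -/
theorem stmt9 (α β Γ ω θ k0 k1 k2 : ℝ) (hθ : θ = 1)
    (hα : 0 < α) (hβ : 0 < β) (hΓ : 0 < Γ) (hω : 0 < ω)
    (ustar vstar : ℝ)
    (hzero : fkin α β Γ ω k1 ustar vstar 1 = 0 ∧ gkin θ k0 k2 ustar vstar 1 = 0 ∧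
      skin ustar vstar 1 = 0)
    (hu0 : 0 < ustar) (hu1 : ustar < 1) (hv : 0 < vstar) :
    (f_v α β Γ ω k1 ustar vstar 1 * g_u θ k0 k2 ustar vstar 1 -
        f_u α β Γ ω k1 ustar vstar 1 * g_v θ k0 k2 ustar vstar 1 < 0) ↔
      ω * β * k0 * Real.exp (-β * (vstar - α)) * vstar / (1 + ustar) < (2 : ℝ) ^ k1 * Γ := by
  subst hθ
  obtain ⟨hf, hg, -⟩ := hzero
  have h2 : (1:ℝ) + 1 = 2 := by norm_num
  unfold fkin at hf
  unfold gkin at hg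
  have hE := Real.exp_pos (-β * (vstar - α))
  have hA : (0:ℝ) < (2:ℝ) ^ k1 := Real.rpow_pos_of_pos (by norm_num) _
  have h1u : 0 < 1 + ustar := by linarith
  have hfu : HasDerivAt (fun x => fkin α β Γ ω k1 x vstar 1)
      ((1 + 1) ^ k1 * (1 / (1 + Real.exp (-β * (vstar - α)))) *
        (Γ * 1 * (1 - ustar) + Γ * ustar * (-1)) - ω * 1) ustar := by
    unfold fkin
    have hx := hasDerivAt_id' ustar
    exact (((hx.const_mul Γ).mul (hx.const_sub 1)).const_mul _).sub (hx.const_mul ω)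
  have hfv : HasDerivAt (fun x => fkin α β Γ ω k1 ustar x 1)
      ((1 + 1) ^ k1 * (-(Real.exp (-β * (vstar - α)) * (-β * 1)) /
        (1 + Real.exp (-β * (vstar - α))) ^ 2) * (Γ * ustar * (1 - ustar))) vstar := by
    unfold fkin
    have hx := hasDerivAt_id' vstar
    have he := ((((hx.sub_const α).const_mul (-β)).exp).const_add 1).inv (by positivity)
    simp only [one_div]
    exact ((he.const_mul _).mul_const _).sub_const _
  have hgu : HasDerivAt (fun x => gkin 1 k0 k2 x vstar 1)
      (-((1 + 1) ^ (-k2) * 1 * (1 * (-k0) * (1 + ustar) ^ (-k0 - 1)) * vstar)) ustar := by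
    unfold gkin
    have hx := ((hasDerivAt_id' ustar).const_add 1).rpow_const (p := -k0) (Or.inl h1u.ne')
    exact ((hx.const_mul _).mul_const _).const_sub _
  have hgv : HasDerivAt (fun x => gkin 1 k0 k2 ustar x 1)
      (-((1 + 1) ^ (-k2) * 1 * (1 + ustar) ^ (-k0) * 1)) vstar := by
    unfold gkin
    exact ((hasDerivAt_id' vstar).const_mul _).const_sub _
  have e1 : f_u α β Γ ω k1 ustar vstar 1 = _ := hfu.deriv
  have e2 : f_v α β Γ ω k1 ustar vstar 1 = _ := hfv.deriv
  have e3 : g_u 1 k0 k2 ustar vstar 1 = _ := hgu.deriv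
  have e4 : g_v 1 k0 k2 ustar vstar 1 = _ := hgv.deriv
  rw [Real.rpow_sub_one h1u.ne'] at e3
  clear hfu hfv hgu hgv
  rw [h2] at hf hg e1 e2 e3 e4
  generalize Real.exp (-β * (vstar - α)) = E at *
  generalize (2:ℝ) ^ k1 = A at *
  generalize (2:ℝ) ^ (-k2) = C at *
  generalize (1 + ustar) ^ (-k0) = B at *
  have hS : 0 < 1 + E := by linarith
  have hw : A * Γ * (1 - ustar) = ω * (1 + E) := by
    field_simp at hf
    have hf' : ustar * (A * Γ * (1 - ustar) - ω * (1 + E)) = 0 := by linarith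
    rcases mul_eq_zero.mp hf' with h | h <;> linarith
  have hCB : C * B = 1 / vstar := by
    field_simp
    linarith
  have e3' : g_u 1 k0 k2 ustar vstar 1 = k0 / (1 + ustar) := by
    rw [e3]
    have : C * B * vstar = 1 := by linarith
    field_simp
    linear_combination k0 * this
  have e4' : g_v 1 k0 k2 ustar vstar 1 = -(1 / vstar) := by
    rw [e4, ← hCB]; ring
  have e1' : f_u α β Γ ω k1 ustar vstar 1 = -(A * Γ * ustar / (1 + E)) := by
    rw [e1]
    field_simp
    linear_combination hw
  have e2' : f_v α β Γ ω k1 ustar vstar 1 = ω * ustar * β * E / (1 + E) := by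
    rw [e2]
    field_simp
    linear_combination hw
  have key : ω * ustar * β * E / (1 + E) * (k0 / (1 + ustar)) -
      -(A * Γ * ustar / (1 + E)) * -(1 / vstar) =
      (ustar / ((1 + E) * vstar)) * (ω * β * k0 * E * vstar / (1 + ustar) - A * Γ) := by
    field_simp
  have hp : 0 < ustar / ((1 + E) * vstar) := by positivity
  rw [e1', e2', e3', e4', key]
  constructor
  · intro h
    by_contra hc
    have := mul_nonneg hp.le (sub_nonneg.mpr (not_lt.mp hc))
    linarith
  · intro h
    exact mul_neg_of_pos_of_neg hp (sub_neg.mpr h)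
end

section
/- Let û₋ = (u*, v*, 1) with u* > 0 and write p = f_u(û₋) + g_v(û₋), q = f_u(û₋)·g_v(û₋) − f_v(û₋)·g_u(û₋). If p < 0, q > 0, and p² − 4q ≥ 0, then all three eigenvalues of DF(û₋) are real and negative; explicitly, they are −u*, (p + √(p²−4q))/2, and (p − √(p²−4q))/2, each of which is negative. -/
open Real Filter

/-- at `û₋ = (u*, v*, 1)` with `u* > 0`, setting
`p = f_u(û₋) + g_v(û₋)` and `q = f_u(û₋)·g_v(û₋) − f_v(û₋)·g_u(û₋)`, if `p < 0`, `q > 0` and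
`p² − 4q ≥ 0`, then all three eigenvalues of `DF(û₋)` are real and negative; explicitly they
are `−u*`, `(p + √(p²−4q))/2` and `(p − √(p²−4q))/2`, each negative. -/
theorem stmt10 (α β Γ ω θ k0 k1 k2 : ℝ) (ustar vstar : ℝ) (hu : 0 < ustar)
    (p q : ℝ)
    (hp : p = f_u α β Γ ω k1 ustar vstar 1 + g_v θ k0 k2 ustar vstar 1)
    (hq : q = f_u α β Γ ω k1 ustar vstar 1 * g_v θ k0 k2 ustar vstar 1 -
      f_v α β Γ ω k1 ustar vstar 1 * g_u θ k0 k2 ustar vstar 1)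
    (hpneg : p < 0) (hqpos : 0 < q) (hdisc : 0 ≤ p ^ 2 - 4 * q) :
    (∀ lam : ℝ,
      Matrix.det (DF α β Γ ω θ k0 k1 k2 ustar vstar 1 -
          lam • (1 : Matrix (Fin 3) (Fin 3) ℝ)) =
        (-ustar - lam) * (lam - (p + Real.sqrt (p ^ 2 - 4 * q)) / 2) *
          (lam - (p - Real.sqrt (p ^ 2 - 4 * q)) / 2)) ∧
    (-ustar : ℝ) < 0 ∧
    (p + Real.sqrt (p ^ 2 - 4 * q)) / 2 < 0 ∧
    (p - Real.sqrt (p ^ 2 - 4 * q)) / 2 < 0 ∧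
    (∀ μ : ℂ,
      ((DF α β Γ ω θ k0 k1 k2 ustar vstar 1).map (algebraMap ℝ ℂ)).charpoly.IsRoot μ →
        μ.im = 0 ∧ μ.re < 0) := by
  have h1 : s_u ustar vstar 1 = 0 := by simp [s_u, skin]
  have h2 : s_v ustar vstar 1 = 0 := by simp [s_v, skin]
  have h3 : s_P ustar vstar 1 = -ustar := by
    unfold s_P skin
    have h : HasDerivAt (fun x : ℝ => ustar * (1 - x)) (ustar * (-1)) 1 :=
      ((hasDerivAt_id (1 : ℝ)).const_sub 1).const_mul ustar
    rw [h.deriv]; ring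
  unfold DF
  rw [h1, h2, h3]
  generalize f_u α β Γ ω k1 ustar vstar 1 = a at *
  generalize f_v α β Γ ω k1 ustar vstar 1 = b at *
  generalize f_P α β Γ ω k1 ustar vstar 1 = c at *
  generalize g_u θ k0 k2 ustar vstar 1 = d at *
  generalize g_v θ k0 k2 ustar vstar 1 = e at *
  generalize g_P θ k0 k2 ustar vstar 1 = f at *
  have hs := Real.sq_sqrt hdisc
  have hs0 := Real.sqrt_nonneg (p ^ 2 - 4 * q)
  generalize Real.sqrt (p ^ 2 - 4 * q) = r at *
  have hr1 : (p + r) / 2 < 0 := by nlinarith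
  have hr2 : (p - r) / 2 < 0 := by linarith
  refine ⟨?_, by linarith, hr1, hr2, ?_⟩
  · intro lam
    have hf : (lam - (p + r) / 2) * (lam - (p - r) / 2) = lam ^ 2 - p * lam + q := by
      linear_combination (-1 / 4) * hs
    rw [mul_assoc, hf, hp, hq]
    simp [Matrix.det_fin_three]
    ring
  · intro μ hμ
    have hs' : (r : ℂ) ^ 2 = (p : ℂ) ^ 2 - 4 * q := by exact_mod_cast hs
    have hp' : (p : ℂ) = a + e := by exact_mod_cast hp
    have hq' : (q : ℂ) = a * e - b * d := by exact_mod_cast hq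
    have hf : (μ - (p + r) / 2) * (μ - (p - r) / 2) = μ ^ 2 - p * μ + q := by
      linear_combination (-1 / 4) * hs'
    have key : (μ + ustar) * ((μ - (p + r) / 2) * (μ - (p - r) / 2)) = 0 := by
      rw [Polynomial.IsRoot, Matrix.eval_charpoly] at hμ
      simp [Matrix.det_fin_three] at hμ
      rw [hf, hp', hq', ← mul_zero (1 : ℂ)]
      first
        | linear_combination hμ
        | (rcases hμ with hμ | hμ <;> grind)
    rcases mul_eq_zero.1 key with h | h
    · have : μ = ((-ustar : ℝ) : ℂ) := by push_cast; linear_combination h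
      rw [this]
      exact ⟨Complex.ofReal_im _, by rw [Complex.ofReal_re]; linarith⟩
    rcases mul_eq_zero.1 h with h | h
    · have : μ = (((p + r) / 2 : ℝ) : ℂ) := by push_cast; linear_combination h
      rw [this]
      exact ⟨Complex.ofReal_im _, by rw [Complex.ofReal_re]; exact hr1⟩
    · have : μ = (((p - r) / 2 : ℝ) : ℂ) := by push_cast; linear_combination h
      rw [this]
      exact ⟨Complex.ofReal_im _, by rw [Complex.ofReal_re]; exact hr2⟩
end

section
/- Assume k0 ≥ 0, k1 ≥ 0, k2 ≥ 0, β ≥ 0, Γ ≥ 0 and θ > 0. Then for every (u, v, P) with 0 ≤ u ≤ 1, v ≥ 0 and 0 ≤ P ≤ 1, all off-diagonal entries of the Jacobian DF(u,v,P) are nonnegative: ∂f/∂v ≥ 0, ∂f/∂P ≥ 0, ∂g/∂u ≥ 0, ∂g/∂P ≥ 0, ∂s/∂u = 1−P ≥ 0, and ∂s/∂v = 0. That is, the system with kinetics F is monotone on this region. -/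
open Real Filter

/-- for `k0, k1, k2, β, Γ ≥ 0` and `θ > 0`, on the region
`0 ≤ u ≤ 1`, `v ≥ 0`, `0 ≤ P ≤ 1` all off-diagonal entries of the Jacobian are nonnegative:
`∂f/∂v ≥ 0`, `∂f/∂P ≥ 0`, `∂g/∂u ≥ 0`, `∂g/∂P ≥ 0`, `∂s/∂u = 1−P ≥ 0`, `∂s/∂v = 0`;
i.e. the system is monotone there. -/
theorem stmt11 (α β Γ ω θ k0 k1 k2 : ℝ)
    (hk0 : 0 ≤ k0) (hk1 : 0 ≤ k1) (hk2 : 0 ≤ k2) (hβ : 0 ≤ β) (hΓ : 0 ≤ Γ) (hθ : 0 < θ)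
    (u v P : ℝ) (hu0 : 0 ≤ u) (hu1 : u ≤ 1) (hv : 0 ≤ v) (hP0 : 0 ≤ P) (hP1 : P ≤ 1) :
    0 ≤ f_v α β Γ ω k1 u v P ∧
    0 ≤ f_P α β Γ ω k1 u v P ∧
    0 ≤ g_u θ k0 k2 u v P ∧
    0 ≤ g_P θ k0 k2 u v P ∧
    s_u u v P = 1 - P ∧ 0 ≤ s_u u v P ∧
    s_v u v P = 0 := by
  have hw : 0 ≤ Γ * u * (1 - u) := mul_nonneg (mul_nonneg hΓ hu0) (by linarith)
  have hP : 0 < 1 + P := by linarith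
  have hu : 0 < 1 + u := by linarith
  have key : ∀ (k x : ℝ), 0 < 1 + x →
      HasDerivAt (fun y : ℝ => (1 + y) ^ k) (k * (1 + x) ^ (k - 1)) x := by
    intro k x hx
    have h := ((hasDerivAt_id x).const_add 1).rpow_const (p := k) (Or.inl hx.ne')
    simpa using h
  have hsu : s_u u v P = 1 - P := by
    unfold s_u skin
    simpa using ((hasDerivAt_id u).mul_const (1 - P)).deriv
  refine ⟨?_, ?_, ?_, ?_, hsu, by rw [hsu]; linarith, ?_⟩
  · unfold f_v
    apply Monotone.deriv_nonneg
    intro x y hxy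
    unfold fkin
    have h1 : Real.exp (-β * (y - α)) ≤ Real.exp (-β * (x - α)) := by
      apply Real.exp_le_exp.mpr
      nlinarith
    have h2 : 1 / (1 + Real.exp (-β * (x - α))) ≤ 1 / (1 + Real.exp (-β * (y - α))) := by
      apply one_div_le_one_div_of_le
      · positivity
      · linarith
    have h3 : 0 ≤ (1 + P) ^ k1 := by positivity
    have h4 := mul_le_mul_of_nonneg_right (mul_le_mul_of_nonneg_left h2 h3) hw
    simpa using h4
  · unfold f_P fkin
    have h := (((key k1 P hP).mul_const (1 / (1 + Real.exp (-β * (v - α))))).mul_const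
      (Γ * u * (1 - u))).sub_const (ω * u)
    rw [h.deriv]
    positivity
  · unfold g_u gkin
    have h := (((key (-k0) u hu).const_mul ((1 + P) ^ (-k2) * θ)).mul_const v).const_sub 1
    rw [h.deriv]
    have : 0 ≤ (1 + P) ^ (-k2) * θ * (k0 * (1 + u) ^ (-k0 - 1)) * v := by positivity
    linarith
  · unfold g_P gkin
    have h := ((((key (-k2) P hP).mul_const θ).mul_const ((1 + u) ^ (-k0))).mul_const v).const_sub 1
    rw [h.deriv]
    have : 0 ≤ k2 * (1 + P) ^ (-k2 - 1) * θ * (1 + u) ^ (-k0) * v := by positivity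
    linarith
  · unfold s_v skin
    simp
end

section
/- Assume θ = 1, α, β, Γ, ω > 0, k1 ≥ 0, k0 > 0, and k2 > 0. Let û¹ = (u₁, v₁, 1) be a zero of F with 0 < u₁ < 1 and v₁ > 0, and suppose f_v(û¹)·g_u(û¹) − f_u(û¹)·g_v(û¹) > 0. Then there exists a vector q = (q₁, q₂, q₃) ∈ ℝ³ with q₁, q₂, q₃ > 0 such that every component of the row vector qᵀ·DF(û¹) is strictly positive; equivalently, q₁ f_u(û¹) + q₂ g_u(û¹) > 0, q₁ f_v(û¹) + q₂ g_v(û¹) > 0, and q₁ f_P(û¹) + q₂ g_P(û¹) + q₃ s_P(û¹) > 0. -/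
open Real Filter

/-- with θ = 1, α, β, Γ, ω > 0, k1 ≥ 0, k0 > 0, k2 > 0, at a zero
`û¹ = (u₁, v₁, 1)` of `F` with `0 < u₁ < 1`, `v₁ > 0`, if
`f_v(û¹)·g_u(û¹) − f_u(û¹)·g_v(û¹) > 0` then there is a strictly positive vector
`q ∈ ℝ³` with every component of the row vector `qᵀ·DF(û¹)` strictly positive; equivalently
`q₁ f_u + q₂ g_u > 0`, `q₁ f_v + q₂ g_v > 0`, `q₁ f_P + q₂ g_P + q₃ s_P > 0` at `û¹`. -/
theorem stmt12 (α β Γ ω θ k0 k1 k2 : ℝ) (hθ : θ = 1)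
    (hα : 0 < α) (hβ : 0 < β) (hΓ : 0 < Γ) (hω : 0 < ω)
    (hk1 : 0 ≤ k1) (hk0 : 0 < k0) (hk2 : 0 < k2)
    (u₁ v₁ : ℝ)
    (hzero : fkin α β Γ ω k1 u₁ v₁ 1 = 0 ∧ gkin θ k0 k2 u₁ v₁ 1 = 0 ∧ skin u₁ v₁ 1 = 0)
    (hu0 : 0 < u₁) (hu1 : u₁ < 1) (hv : 0 < v₁)
    (hcond : 0 < f_v α β Γ ω k1 u₁ v₁ 1 * g_u θ k0 k2 u₁ v₁ 1 -
      f_u α β Γ ω k1 u₁ v₁ 1 * g_v θ k0 k2 u₁ v₁ 1) :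
    ∃ q : Fin 3 → ℝ, (∀ i, 0 < q i) ∧
      (∀ j, 0 < Matrix.vecMul q (DF α β Γ ω θ k0 k1 k2 u₁ v₁ 1) j) ∧
      0 < q 0 * f_u α β Γ ω k1 u₁ v₁ 1 + q 1 * g_u θ k0 k2 u₁ v₁ 1 ∧
      0 < q 0 * f_v α β Γ ω k1 u₁ v₁ 1 + q 1 * g_v θ k0 k2 u₁ v₁ 1 ∧
      0 < q 0 * f_P α β Γ ω k1 u₁ v₁ 1 + q 1 * g_P θ k0 k2 u₁ v₁ 1 + q 2 * s_P u₁ v₁ 1 := by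
  subst hθ
  obtain ⟨hf, hg, -⟩ := hzero
  have hE : 0 < Real.exp (-β * (v₁ - α)) := Real.exp_pos _
  have h2k : (0:ℝ) < (1 + 1) ^ k1 := Real.rpow_pos_of_pos (by norm_num) _
  have h2k' : (0:ℝ) < (1 + 1) ^ (-k2) := Real.rpow_pos_of_pos (by norm_num) _
  have huk : (0:ℝ) < (1 + u₁) ^ (-k0) := Real.rpow_pos_of_pos (by linarith) _
  have hfu : f_u α β Γ ω k1 u₁ v₁ 1 < 0 := by
    unfold f_u
    unfold fkin at hf ⊢
    set C : ℝ := (1 + 1) ^ k1 * (1 / (1 + Real.exp (-β * (v₁ - α)))) with hC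
    have hCpos : 0 < C := by positivity
    have hd : HasDerivAt (fun x : ℝ => C * (Γ * x * (1 - x)) - ω * x)
        (C * (Γ * 1 * (1 - u₁) + Γ * u₁ * (-1)) - ω * 1) u₁ :=
      (((((hasDerivAt_id u₁).const_mul Γ).mul ((hasDerivAt_id u₁).const_sub 1)).const_mul C).sub
        ((hasDerivAt_id u₁).const_mul ω))
    rw [hd.deriv]
    have h1 : u₁ * (C * Γ * (1 - u₁) - ω) = 0 := by linarith
    have h2 : C * Γ * (1 - u₁) - ω = 0 := by
      rcases mul_eq_zero.mp h1 with h | h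
      · linarith
      · exact h
    have h3 : 0 < C * Γ * u₁ := by positivity
    linarith
  have hfv : 0 ≤ f_v α β Γ ω k1 u₁ v₁ 1 := by
    unfold f_v
    apply Monotone.deriv_nonneg
    intro x y hxy
    unfold fkin
    beta_reduce
    have : 0 ≤ Γ * u₁ * (1 - u₁) := mul_nonneg (by positivity) (by linarith)
    have h4 : -β * (y - α) ≤ -β * (x - α) := by nlinarith
    gcongr
  have hgu : 0 ≤ g_u 1 k0 k2 u₁ v₁ 1 := by
    unfold g_u gkin
    have hd := (((((hasDerivAt_id u₁).const_add 1).rpow_const (p := -k0)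
      (Or.inl (by simp; linarith))).const_mul ((1 + 1 : ℝ) ^ (-k2) * 1)).mul_const v₁).const_sub 1
    have h5 : (0:ℝ) < (1 + u₁) ^ (-k0 - 1) := Real.rpow_pos_of_pos (by linarith) _
    have h6 := hd.deriv
    simp only [id] at h6
    rw [h6]
    have : 0 < (1 + 1 : ℝ) ^ (-k2) * 1 * (k0 * (1 + u₁) ^ (-k0 - 1)) * v₁ := by positivity
    linarith
  have hgv : g_v 1 k0 k2 u₁ v₁ 1 < 0 := by
    unfold g_v gkin
    have hd := ((hasDerivAt_id v₁).const_mul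
      ((1 + 1 : ℝ) ^ (-k2) * 1 * (1 + u₁) ^ (-k0))).const_sub 1
    have h6 := hd.deriv
    simp only [id] at h6
    rw [h6]
    have : 0 < (1 + 1 : ℝ) ^ (-k2) * 1 * (1 + u₁) ^ (-k0) := by positivity
    linarith
  have hfP : 0 ≤ f_P α β Γ ω k1 u₁ v₁ 1 := by
    unfold f_P fkin
    have hd := (((((hasDerivAt_id (1:ℝ)).const_add 1).rpow_const (p := k1)
      (Or.inl (by norm_num))).mul_const (1 / (1 + Real.exp (-β * (v₁ - α))))).mul_const
        (Γ * u₁ * (1 - u₁))).sub_const (ω * u₁)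
    have h6 := hd.deriv
    simp only [id] at h6
    rw [h6]
    have : 0 ≤ 1 - u₁ := by linarith
    positivity
  have hgP : 0 < g_P 1 k0 k2 u₁ v₁ 1 := by
    unfold g_P gkin
    have hd := ((((((hasDerivAt_id (1:ℝ)).const_add 1).rpow_const (p := -k2)
      (Or.inl (by norm_num))).mul_const 1).mul_const ((1 + u₁) ^ (-k0))).mul_const
        v₁).const_sub 1
    have h5 : (0:ℝ) < (1 + 1) ^ (-k2 - 1) := Real.rpow_pos_of_pos (by norm_num) _
    have h6 := hd.deriv
    simp only [id] at h6
    rw [h6]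
    have : 0 < k2 * (1 + 1 : ℝ) ^ (-k2 - 1) * (1 + u₁) ^ (-k0) * v₁ := by positivity
    linarith
  have hsu : s_u u₁ v₁ 1 = 0 := by simp [s_u, skin]
  have hsv : s_v u₁ v₁ 1 = 0 := by simp [s_v, skin]
  have hsP : s_P u₁ v₁ 1 = -u₁ := by
    unfold s_P skin
    have h6 := (((hasDerivAt_id (1:ℝ)).const_sub 1).const_mul u₁).deriv
    simp only [id] at h6
    rw [h6]; ring
  unfold DF
  rw [hsu, hsv, hsP]
  generalize f_u α β Γ ω k1 u₁ v₁ 1 = fu at *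
  generalize f_v α β Γ ω k1 u₁ v₁ 1 = fv at *
  generalize f_P α β Γ ω k1 u₁ v₁ 1 = fP at *
  generalize g_u 1 k0 k2 u₁ v₁ 1 = gu at *
  generalize g_v 1 k0 k2 u₁ v₁ 1 = gv at *
  generalize g_P 1 k0 k2 u₁ v₁ 1 = gP at *
  have hq1 : 0 < gu - gv := by linarith
  have hq2 : 0 < fv - fu := by linarith
  have hD : 0 < (gu - gv) * fP + (fv - fu) * gP := by positivity
  have c1 : 0 < (gu - gv) * fu + (fv - fu) * gu := by linarith
  have c2 : 0 < (gu - gv) * fv + (fv - fu) * gv := by linarith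
  have c3 : 0 < (gu - gv) * fP + (fv - fu) * gP +
      ((gu - gv) * fP + (fv - fu) * gP) / (2 * u₁) * (-u₁) := by
    have : ((gu - gv) * fP + (fv - fu) * gP) / (2 * u₁) * (-u₁) =
        -(((gu - gv) * fP + (fv - fu) * gP) / 2) := by field_simp
    rw [this]; linarith
  refine ⟨![gu - gv, fv - fu, ((gu - gv) * fP + (fv - fu) * gP) / (2 * u₁)], ?_, ?_, c1, c2, c3⟩
  · intro i
    fin_cases i
    · exact hq1
    · exact hq2
    · exact div_pos hD (by linarith)
  · intro j
    have e : ∀ (q : Fin 3 → ℝ) (M : Matrix (Fin 3) (Fin 3) ℝ) (j : Fin 3),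
        Matrix.vecMul q M j = q 0 * M 0 j + q 1 * M 1 j + q 2 * M 2 j := by
      intro q M j
      simp [Matrix.vecMul, dotProduct, Fin.sum_univ_three]
    rw [e]
    fin_cases j
    · simpa using c1
    · simpa using c2
    · simpa using c3
end

section
/- Assume θ = 1. Let P₀ ∈ [0,1], v₀ = (1+P₀)^{k2}, û₊ = (0, v₀, P₀), and let A = diag(1,1,0), and c, σ ∈ ℝ. Then det(σ²A − cσI + DF(û₊) − λI) = (σ² − cσ + a − λ)·(σ² − cσ + b − λ)·(−cσ − λ), where a = f_u(û₊) and b = g_v(û₊); hence the eigenvalues of the matrix σ²A − cσI + DF(û₊) are σ² − cσ + f_u(û₊), σ² − cσ + g_v(û₊), and −cσ. -/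
open Real Filter

/-- with θ = 1, at the trivial steady state `û₊ = (0, v₀, P₀)`,
`v₀ = (1+P₀)^{k2}`, `P₀ ∈ [0,1]`, with `A = diag(1,1,0)` and `c, σ ∈ ℝ`:
`det(σ²A − cσI + DF(û₊) − λI) = (σ²−cσ+a−λ)(σ²−cσ+b−λ)(−cσ−λ)` with `a = f_u(û₊)`,
`b = g_v(û₊)`; hence the eigenvalues of `σ²A − cσI + DF(û₊)` are `σ²−cσ+a`, `σ²−cσ+b`, `−cσ`. -/
theorem stmt13 (α β Γ ω θ k0 k1 k2 c σ : ℝ) (hθ : θ = 1)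
    (P₀ : ℝ) (hP₀ : P₀ ∈ Set.Icc (0 : ℝ) 1) :
    (∀ lam : ℝ,
      Matrix.det (σ ^ 2 • (Matrix.diagonal ![1, 1, 0] : Matrix (Fin 3) (Fin 3) ℝ) -
          (c * σ) • (1 : Matrix (Fin 3) (Fin 3) ℝ) +
          DF α β Γ ω θ k0 k1 k2 0 ((1 + P₀) ^ k2) P₀ -
          lam • (1 : Matrix (Fin 3) (Fin 3) ℝ)) =
        (σ ^ 2 - c * σ + f_u α β Γ ω k1 0 ((1 + P₀) ^ k2) P₀ - lam) *
          (σ ^ 2 - c * σ + g_v θ k0 k2 0 ((1 + P₀) ^ k2) P₀ - lam) *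
          (-(c * σ) - lam)) ∧
    (∀ μ : ℝ,
      Matrix.det (σ ^ 2 • (Matrix.diagonal ![1, 1, 0] : Matrix (Fin 3) (Fin 3) ℝ) -
          (c * σ) • (1 : Matrix (Fin 3) (Fin 3) ℝ) +
          DF α β Γ ω θ k0 k1 k2 0 ((1 + P₀) ^ k2) P₀ -
          μ • (1 : Matrix (Fin 3) (Fin 3) ℝ)) = 0 ↔
        μ = σ ^ 2 - c * σ + f_u α β Γ ω k1 0 ((1 + P₀) ^ k2) P₀ ∨
          μ = σ ^ 2 - c * σ + g_v θ k0 k2 0 ((1 + P₀) ^ k2) P₀ ∨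
          μ = -(c * σ)) := by
  have hfv : f_v α β Γ ω k1 0 ((1 + P₀) ^ k2) P₀ = 0 := by simp [f_v, fkin]
  have hfP : f_P α β Γ ω k1 0 ((1 + P₀) ^ k2) P₀ = 0 := by simp [f_P, fkin]
  have hsv : s_v 0 ((1 + P₀) ^ k2) P₀ = 0 := by simp [s_v, skin]
  have hsP : s_P 0 ((1 + P₀) ^ k2) P₀ = 0 := by simp [s_P, skin]
  have key : ∀ lam : ℝ,
      Matrix.det (σ ^ 2 • (Matrix.diagonal ![1, 1, 0] : Matrix (Fin 3) (Fin 3) ℝ) -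
          (c * σ) • (1 : Matrix (Fin 3) (Fin 3) ℝ) +
          DF α β Γ ω θ k0 k1 k2 0 ((1 + P₀) ^ k2) P₀ -
          lam • (1 : Matrix (Fin 3) (Fin 3) ℝ)) =
        (σ ^ 2 - c * σ + f_u α β Γ ω k1 0 ((1 + P₀) ^ k2) P₀ - lam) *
          (σ ^ 2 - c * σ + g_v θ k0 k2 0 ((1 + P₀) ^ k2) P₀ - lam) *
          (-(c * σ) - lam) := by
    intro lam
    rw [Matrix.det_fin_three]
    simp [DF, hfv, hfP, hsv, hsP, Matrix.one_apply, Matrix.diagonal_apply]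
  refine ⟨key, fun μ => ?_⟩
  rw [key, mul_eq_zero, mul_eq_zero, sub_eq_zero, sub_eq_zero, sub_eq_zero, or_assoc]
  simp only [eq_comm]
end

section
/- Assume θ = 1 and c ≠ 0. Let P₀ ∈ [0,1], v₀ = (1+P₀)^{k2}, û₊ = (0, v₀, P₀), and let M be the 5×5 real matrix M = [[0,0,0,1,0],[0,0,0,0,1],[−s_u/c, 0, −s_P/c, 0, 0],[−f_u, −f_v, −f_P, −c, 0],[−g_u, −g_v, −g_P, 0, −c]] with all partial derivatives evaluated at û₊ (so f_v(û₊) = f_P(û₊) = 0, s_P(û₊) = 0, s_u(û₊) = 1−P₀). Then det(M − λI) = −λ·(λ² + cλ + f_u(û₊))·(λ² + cλ + g_v(û₊)). Consequently, if c² ≥ 4 f_u(û₊) (and noting g_v(û₊) < 0 so c² − 4 g_v(û₊) > 0), the eigenvalues of M are 0, (−c ± √(c² − 4 f_u(û₊)))/2, and (−c ± √(c² − 4 g_v(û₊)))/2. -/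
open Real Filter

theorem det_aux (a b d e h c l : ℝ) (g : ℝ) :
    Matrix.det (!![0, 0, 0, 1, 0; 0, 0, 0, 0, 1; a, 0, 0, 0, 0; -b, 0, 0, -c, 0;
      d, -e, h, 0, g] - l • (1 : Matrix (Fin 5) (Fin 5) ℝ)) =
    -l * (l ^ 2 + c * l + b) * (l ^ 2 - g * l + e) := by
  have : (!![0, 0, 0, 1, 0; 0, 0, 0, 0, 1; a, 0, 0, 0, 0; -b, 0, 0, -c, 0;
      d, -e, h, 0, g] - l • (1 : Matrix (Fin 5) (Fin 5) ℝ)) =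
      !![-l, 0, 0, 1, 0; 0, -l, 0, 0, 1; a, 0, -l, 0, 0; -b, 0, 0, -c - l, 0;
      d, -e, h, 0, g - l] := by
    ext i j
    fin_cases i <;> fin_cases j <;> simp [Matrix.one_apply]
  rw [this]
  simp [Matrix.det_succ_row_zero, Fin.sum_univ_succ, Fin.succAbove, Matrix.submatrix]
  ring

theorem quad_aux (c b x : ℝ) (h : 0 ≤ c ^ 2 - 4 * b) :
    x ^ 2 + c * x + b = 0 ↔ x = (-c + Real.sqrt (c ^ 2 - 4 * b)) / 2 ∨
      x = (-c - Real.sqrt (c ^ 2 - 4 * b)) / 2 := by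
  have hs := Real.sq_sqrt h
  set r := Real.sqrt (c ^ 2 - 4 * b)
  have e : x ^ 2 + c * x + b = (x - (-c + r) / 2) * (x - (-c - r) / 2) := by
    linear_combination (1 / 4) * hs
  rw [e, mul_eq_zero, sub_eq_zero, sub_eq_zero]

/-- with θ = 1 and `c ≠ 0`, at the trivial steady state
`û₊ = (0, v₀, P₀)`, `v₀ = (1+P₀)^{k2}`, `P₀ ∈ [0,1]`, the linearization matrix `M` of the
first-order traveling-wave system satisfies
`det(M − λI) = −λ(λ² + cλ + f_u(û₊))(λ² + cλ + g_v(û₊))`; consequently, if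
`c² ≥ 4 f_u(û₊)`, the eigenvalues of `M` are `0`, `(−c ± √(c²−4f_u(û₊)))/2`, and
`(−c ± √(c²−4g_v(û₊)))/2`. -/
theorem stmt15 (α β Γ ω θ k0 k1 k2 c : ℝ) (hθ : θ = 1) (hc : c ≠ 0)
    (P₀ : ℝ) (hP₀ : P₀ ∈ Set.Icc (0 : ℝ) 1)
    (M : Matrix (Fin 5) (Fin 5) ℝ)
    (hM : M =
      !![0, 0, 0, 1, 0;
         0, 0, 0, 0, 1;
         -(s_u 0 ((1 + P₀) ^ k2) P₀) / c, 0, -(s_P 0 ((1 + P₀) ^ k2) P₀) / c, 0, 0;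
         -(f_u α β Γ ω k1 0 ((1 + P₀) ^ k2) P₀), -(f_v α β Γ ω k1 0 ((1 + P₀) ^ k2) P₀),
           -(f_P α β Γ ω k1 0 ((1 + P₀) ^ k2) P₀), -c, 0;
         -(g_u θ k0 k2 0 ((1 + P₀) ^ k2) P₀), -(g_v θ k0 k2 0 ((1 + P₀) ^ k2) P₀),
           -(g_P θ k0 k2 0 ((1 + P₀) ^ k2) P₀), 0, -c]) :
    (∀ lam : ℝ,
      Matrix.det (M - lam • (1 : Matrix (Fin 5) (Fin 5) ℝ)) =
        -lam * (lam ^ 2 + c * lam + f_u α β Γ ω k1 0 ((1 + P₀) ^ k2) P₀) *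
          (lam ^ 2 + c * lam + g_v θ k0 k2 0 ((1 + P₀) ^ k2) P₀)) ∧
    (c ^ 2 ≥ 4 * f_u α β Γ ω k1 0 ((1 + P₀) ^ k2) P₀ →
      ∀ μ : ℝ,
        Matrix.det (M - μ • (1 : Matrix (Fin 5) (Fin 5) ℝ)) = 0 ↔
          μ = 0 ∨
          μ = (-c + Real.sqrt (c ^ 2 - 4 * f_u α β Γ ω k1 0 ((1 + P₀) ^ k2) P₀)) / 2 ∨
          μ = (-c - Real.sqrt (c ^ 2 - 4 * f_u α β Γ ω k1 0 ((1 + P₀) ^ k2) P₀)) / 2 ∨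
          μ = (-c + Real.sqrt (c ^ 2 - 4 * g_v θ k0 k2 0 ((1 + P₀) ^ k2) P₀)) / 2 ∨
          μ = (-c - Real.sqrt (c ^ 2 - 4 * g_v θ k0 k2 0 ((1 + P₀) ^ k2) P₀)) / 2) := by
  have hsP : ∀ v P, s_P 0 v P = 0 := by
    intro v P; simp [s_P, skin]
  have hfv : ∀ v P, f_v α β Γ ω k1 0 v P = 0 := by
    intro v P; simp [f_v, fkin]
  have hfP : ∀ v P, f_P α β Γ ω k1 0 v P = 0 := by
    intro v P; simp [f_P, fkin]
  have hgv : ∀ v, g_v θ k0 k2 0 v P₀ ≤ 0 := by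
    intro v
    have hd : HasDerivAt (fun x => gkin θ k0 k2 0 x P₀)
        (-((1 + P₀) ^ (-k2) * θ * (1 + 0) ^ (-k0) * 1)) v := by
      unfold gkin
      exact ((hasDerivAt_id v).const_mul _).const_sub 1
    have : 0 ≤ (1 + P₀) ^ (-k2) := Real.rpow_nonneg (by linarith [hP₀.1]) _
    rw [g_v, hd.deriv, hθ]
    simpa using this
  have key : ∀ lam : ℝ,
      Matrix.det (M - lam • (1 : Matrix (Fin 5) (Fin 5) ℝ)) =
        -lam * (lam ^ 2 + c * lam + f_u α β Γ ω k1 0 ((1 + P₀) ^ k2) P₀) *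
          (lam ^ 2 + c * lam + g_v θ k0 k2 0 ((1 + P₀) ^ k2) P₀) := by
    intro lam
    rw [hM, hsP, hfv, hfP]
    simp only [neg_zero, zero_div]
    rw [det_aux]
    ring
  refine ⟨key, fun hcf μ => ?_⟩
  rw [key, mul_eq_zero, mul_eq_zero, neg_eq_zero, quad_aux _ _ _ (by linarith),
    quad_aux _ _ _ (by nlinarith [hgv ((1 + P₀) ^ k2), sq_nonneg c])]
  tauto
end
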